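/- arXiv:1109.2762 — 2 statements merged into one kernel-verified Lean document; each statement's English description precedes it below -/
import Mathlib

section
/- Continuous selection lemma: Let ψ ∈ C(∂Ω,ℝⁿ) and ε>0. Then there exists a continuous map (γ,g) ∈ C(∂Ω, ℝⁿ×ℝ) such that for all x ∈ ∂Ω: (γ(x),g(x)) ∈ 𝒢(x) (i.e. B(x,p) ≥ γ(x)·p − g(x) for all p ∈ ℝⁿ) and B(x,ψ(x)) < ε + γ(x)·ψ(x) − g(x). -/
open Set MeasureTheory
open scoped RealInnerProductSpace

noncomputable section

/-- Euclidean space ℝⁿ. -/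
abbrev Euc (n : ℕ) : Type := EuclideanSpace ℝ (Fin n)

variable {n : ℕ}

/-- Viscosity subsolution of the Cauchy–Neumann problem (CN):
`u_t + H(x,Du) = 0` in `Ω × (0,∞)`, `B(x,Du) = 0` on `∂Ω × (0,∞)`,
boundary condition in the viscosity sense. -/
def IsCNSubsol (Ω : Set (Euc n)) (H B : Euc n → Euc n → ℝ) (u : Euc n → ℝ → ℝ) : Prop :=
  ∀ φ : Euc n × ℝ → ℝ, ContDiff ℝ 1 φ →
    ∀ x : Euc n, ∀ t : ℝ, x ∈ closure Ω → 0 < t →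
      IsLocalMaxOn (fun z : Euc n × ℝ => u z.1 z.2 - φ z) (closure Ω ×ˢ Ioi (0:ℝ)) (x, t) →
      (x ∈ Ω → deriv (fun s => φ (x, s)) t + H x (gradient (fun y => φ (y, t)) x) ≤ 0) ∧
      (x ∈ frontier Ω →
        min (deriv (fun s => φ (x, s)) t + H x (gradient (fun y => φ (y, t)) x))
          (B x (gradient (fun y => φ (y, t)) x)) ≤ 0)

/-- Viscosity supersolution of (CN). -/
def IsCNSupersol (Ω : Set (Euc n)) (H B : Euc n → Euc n → ℝ) (u : Euc n → ℝ → ℝ) : Prop :=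
  ∀ φ : Euc n × ℝ → ℝ, ContDiff ℝ 1 φ →
    ∀ x : Euc n, ∀ t : ℝ, x ∈ closure Ω → 0 < t →
      IsLocalMinOn (fun z : Euc n × ℝ => u z.1 z.2 - φ z) (closure Ω ×ˢ Ioi (0:ℝ)) (x, t) →
      (x ∈ Ω → 0 ≤ deriv (fun s => φ (x, s)) t + H x (gradient (fun y => φ (y, t)) x)) ∧
      (x ∈ frontier Ω →
        0 ≤ max (deriv (fun s => φ (x, s)) t + H x (gradient (fun y => φ (y, t)) x))
          (B x (gradient (fun y => φ (y, t)) x)))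

/-- Viscosity subsolution of the dynamical boundary condition problem (DBC):
`u_t + H(x,Du) = 0` in `Ω × (0,∞)`, `u_t + B(x,Du) = 0` on `∂Ω × (0,∞)`. -/
def IsDBCSubsol (Ω : Set (Euc n)) (H B : Euc n → Euc n → ℝ) (u : Euc n → ℝ → ℝ) : Prop :=
  ∀ φ : Euc n × ℝ → ℝ, ContDiff ℝ 1 φ →
    ∀ x : Euc n, ∀ t : ℝ, x ∈ closure Ω → 0 < t →
      IsLocalMaxOn (fun z : Euc n × ℝ => u z.1 z.2 - φ z) (closure Ω ×ˢ Ioi (0:ℝ)) (x, t) →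
      (x ∈ Ω → deriv (fun s => φ (x, s)) t + H x (gradient (fun y => φ (y, t)) x) ≤ 0) ∧
      (x ∈ frontier Ω →
        min (deriv (fun s => φ (x, s)) t + H x (gradient (fun y => φ (y, t)) x))
          (deriv (fun s => φ (x, s)) t + B x (gradient (fun y => φ (y, t)) x)) ≤ 0)

/-- Viscosity supersolution of (DBC). -/
def IsDBCSupersol (Ω : Set (Euc n)) (H B : Euc n → Euc n → ℝ) (u : Euc n → ℝ → ℝ) : Prop :=
  ∀ φ : Euc n × ℝ → ℝ, ContDiff ℝ 1 φ →
    ∀ x : Euc n, ∀ t : ℝ, x ∈ closure Ω → 0 < t →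
      IsLocalMinOn (fun z : Euc n × ℝ => u z.1 z.2 - φ z) (closure Ω ×ˢ Ioi (0:ℝ)) (x, t) →
      (x ∈ Ω → 0 ≤ deriv (fun s => φ (x, s)) t + H x (gradient (fun y => φ (y, t)) x)) ∧
      (x ∈ frontier Ω →
        0 ≤ max (deriv (fun s => φ (x, s)) t + H x (gradient (fun y => φ (y, t)) x))
          (deriv (fun s => φ (x, s)) t + B x (gradient (fun y => φ (y, t)) x)))

/-- Solution of (CN) with initial datum `u₀`. -/
def IsCNSol (Ω : Set (Euc n)) (H B : Euc n → Euc n → ℝ) (u₀ : Euc n → ℝ)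
    (u : Euc n → ℝ → ℝ) : Prop :=
  IsCNSubsol Ω H B u ∧ IsCNSupersol Ω H B u ∧ ∀ x ∈ closure Ω, u x 0 = u₀ x

/-- Solution of (DBC) with initial datum `u₀`. -/
def IsDBCSol (Ω : Set (Euc n)) (H B : Euc n → Euc n → ℝ) (u₀ : Euc n → ℝ)
    (u : Euc n → ℝ → ℝ) : Prop :=
  IsDBCSubsol Ω H B u ∧ IsDBCSupersol Ω H B u ∧ ∀ x ∈ closure Ω, u x 0 = u₀ x

/-- Viscosity subsolution of the stationary (ergodic) problem:
`H(x,Dw) = a` in `Ω`, `B(x,Dw) = b` on `∂Ω` (viscosity sense).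
(E1) corresponds to `b = 0`, (E2) to `b = a`. -/
def IsStatSubsol (Ω : Set (Euc n)) (H B : Euc n → Euc n → ℝ) (a b : ℝ) (w : Euc n → ℝ) : Prop :=
  ∀ φ : Euc n → ℝ, ContDiff ℝ 1 φ →
    ∀ x ∈ closure Ω, IsLocalMaxOn (fun y => w y - φ y) (closure Ω) x →
      (x ∈ Ω → H x (gradient φ x) ≤ a) ∧
      (x ∈ frontier Ω → min (H x (gradient φ x) - a) (B x (gradient φ x) - b) ≤ 0)

/-- Viscosity supersolution of the stationary (ergodic) problem. -/
def IsStatSupersol (Ω : Set (Euc n)) (H B : Euc n → Euc n → ℝ) (a b : ℝ) (w : Euc n → ℝ) : Prop :=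
  ∀ φ : Euc n → ℝ, ContDiff ℝ 1 φ →
    ∀ x ∈ closure Ω, IsLocalMinOn (fun y => w y - φ y) (closure Ω) x →
      (x ∈ Ω → a ≤ H x (gradient φ x)) ∧
      (x ∈ frontier Ω → 0 ≤ max (H x (gradient φ x) - a) (B x (gradient φ x) - b))

/-- Viscosity solution of the stationary (ergodic) problem. -/
def IsStatSol (Ω : Set (Euc n)) (H B : Euc n → Euc n → ℝ) (a b : ℝ) (w : Euc n → ℝ) : Prop :=
  IsStatSubsol Ω H B a b w ∧ IsStatSupersol Ω H B a b w

/-- `(γ,g) ∈ 𝒢(y)`, i.e. the affine function `p ↦ γ·p − g` minorizes `B(y,·)`. -/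
def InG (B : Euc n → Euc n → ℝ) (y γ : Euc n) (g : ℝ) : Prop :=
  ∀ p : Euc n, ⟪γ, p⟫ - g ≤ B y p

/-- The Skorokhod problem data on `[0,T]`: `(η,v,l)` (with `ηd = η̇` and multiplier `f`)
belongs to `SP_T(x)`. -/
def SPT (Ω : Set (Euc n)) (B : Euc n → Euc n → ℝ) (T : ℝ) (x : Euc n)
    (η ηd v : ℝ → Euc n) (l f : ℝ → ℝ) : Prop :=
  η 0 = x ∧
  (∀ t ∈ Icc (0:ℝ) T, η t ∈ closure Ω) ∧
  IntegrableOn ηd (Icc (0:ℝ) T) ∧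
  (∀ t ∈ Icc (0:ℝ) T, η t = x + ∫ s in (0:ℝ)..t, ηd s) ∧
  IntegrableOn v (Icc (0:ℝ) T) ∧
  IntegrableOn l (Icc (0:ℝ) T) ∧
  IntegrableOn f (Icc (0:ℝ) T) ∧
  (∀ᵐ t ∂(volume.restrict (Icc (0:ℝ) T)),
    0 ≤ l t ∧ (η t ∈ Ω → l t = 0) ∧
    (l t = 0 → ηd t = v t ∧ f t = 0) ∧
    (0 < l t → ∃ γ : Euc n, ∃ g : ℝ, InG B (η t) γ g ∧
      v t - ηd t = l t • γ ∧ f t = l t * g))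

/-- The Skorokhod problem data on `[0,∞)`. -/
def SPinf (Ω : Set (Euc n)) (B : Euc n → Euc n → ℝ) (x : Euc n)
    (η ηd v : ℝ → Euc n) (l f : ℝ → ℝ) : Prop :=
  ∀ T : ℝ, 0 < T → SPT Ω B T x η ηd v l f

/-- Assumption (A6)₊ with explicit `η₀`. -/
def A6plusOn (Ω : Set (Euc n)) (H : Euc n → Euc n → ℝ) (η₀ : ℝ) : Prop :=
  ∀ η : ℝ, 0 < η → η ≤ η₀ → ∃ ψ : ℝ, 0 < ψ ∧
    ∀ x ∈ closure Ω, ∀ p q : Euc n, η ≤ H x (p + q) → H x q ≤ 0 →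
      ∀ μ : ℝ, 0 < μ → μ ≤ 1 →
        H x (p + q) + ψ * (1 - μ) ≤ μ * H x (μ⁻¹ • p + q)

/-- Assumption (A6)₋ with explicit `η₀`. -/
def A6minusOn (Ω : Set (Euc n)) (H : Euc n → Euc n → ℝ) (η₀ : ℝ) : Prop :=
  ∀ η : ℝ, 0 < η → η ≤ η₀ → ∃ ψ : ℝ, 0 < ψ ∧
    ∀ x ∈ closure Ω, ∀ p q : Euc n, H x (p + q) ≤ -η → H x q ≤ 0 →
      ∀ μ : ℝ, 1 ≤ μ →
        μ * H x (μ⁻¹ • p + q) ≤ H x (p + q) - ψ * (μ - 1) / μ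

/-- Assumption (A6): (A6)₊ or (A6)₋. -/
def A6 (Ω : Set (Euc n)) (H : Euc n → Euc n → ℝ) : Prop :=
  (∃ η₀ : ℝ, 0 < η₀ ∧ A6plusOn Ω H η₀) ∨ (∃ η₀ : ℝ, 0 < η₀ ∧ A6minusOn Ω H η₀)

/-- Assumption (A7)₊ at level `c`. -/
def A7plus (Ω : Set (Euc n)) (H : Euc n → Euc n → ℝ) (c : ℝ) : Prop :=
  ∃ ω : ℝ → ℝ, ContinuousOn ω (Ici 0) ∧ MonotoneOn ω (Ici 0) ∧ ω 0 = 0 ∧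
    (∀ r : ℝ, 0 < r → 0 < ω r) ∧
    ∀ x ∈ closure Ω, ∀ p ξ q : Euc n, H x p = c →
      (∀ p' : Euc n, H x p + ⟪ξ, p' - p⟫ ≤ H x p') →
      c + ⟪ξ, q⟫ + ω (max ⟪ξ, q⟫ 0) ≤ H x (p + q)

/-- Assumption (A7)₋ at level `c`. -/
def A7minus (Ω : Set (Euc n)) (H : Euc n → Euc n → ℝ) (c : ℝ) : Prop :=
  ∃ ω : ℝ → ℝ, ContinuousOn ω (Ici 0) ∧ MonotoneOn ω (Ici 0) ∧ ω 0 = 0 ∧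
    (∀ r : ℝ, 0 < r → 0 < ω r) ∧
    ∀ x ∈ closure Ω, ∀ p ξ q : Euc n, H x p = c →
      (∀ p' : Euc n, H x p + ⟪ξ, p' - p⟫ ≤ H x p') →
      c + ⟪ξ, q⟫ + ω (max (-⟪ξ, q⟫) 0) ≤ H x (p + q)

/-- Assumption (A7) at level `c`: convexity of `H(x,·)` plus (A7)₊ or (A7)₋. -/
def A7 (Ω : Set (Euc n)) (H : Euc n → Euc n → ℝ) (c : ℝ) : Prop :=
  (∀ x ∈ closure Ω, ConvexOn ℝ univ (H x)) ∧ (A7plus Ω H c ∨ A7minus Ω H c)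

/-- The superdifferential of `w` at `x`, relative to `closure Ω`. -/
def SuperDiff (Ω : Set (Euc n)) (w : Euc n → ℝ) (x : Euc n) : Set (Euc n) :=
  {q | ∀ ε : ℝ, 0 < ε → ∃ δ : ℝ, 0 < δ ∧
    ∀ y ∈ closure Ω, ‖y - x‖ < δ → w y ≤ w x + ⟪q, y - x⟫ + ε * ‖y - x‖}


section ProximalSlope

open Filter Topology

variable {E : Type*} [NormedAddCommGroup E] [InnerProductSpace ℝ E]

/-- `γ` is a subgradient of `f` at the point `a - δ • γ`. For convex `f` and `δ > 0`, this means that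
`γ` is the gradient at `a` of the Moreau envelope of `f` with parameter `δ`. -/
def IsProxSlope (f : E → ℝ) (δ : ℝ) (a γ : E) : Prop :=
  ∀ p, f (a - δ • γ) + ⟪γ, p - (a - δ • γ)⟫ ≤ f p

theorem IsProxSlope.unique {f : E → ℝ} {δ : ℝ} (hδ : 0 < δ) {a γ₁ γ₂ : E}
    (h₁ : IsProxSlope f δ a γ₁) (h₂ : IsProxSlope f δ a γ₂) : γ₁ = γ₂ := by
  have h := add_le_add (h₁ (a - δ • γ₂)) (h₂ (a - δ • γ₁))
  have e₁ : a - δ • γ₂ - (a - δ • γ₁) = δ • (γ₁ - γ₂) := by module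
  have e₂ : a - δ • γ₁ - (a - δ • γ₂) = -(δ • (γ₁ - γ₂)) := by module
  have e₃ : ⟪γ₁, δ • (γ₁ - γ₂)⟫ - ⟪γ₂, δ • (γ₁ - γ₂)⟫ = δ * ‖γ₁ - γ₂‖ ^ 2 := by
    rw [← inner_sub_left, real_inner_smul_right, real_inner_self_eq_norm_sq]
  rw [e₁, e₂, inner_neg_right] at h
  have h0 : ‖γ₁ - γ₂‖ ^ 2 ≤ 0 := by
    by_contra! hpos
    linarith [mul_pos hδ hpos]
  exact sub_eq_zero.1 (norm_eq_zero.1 (pow_eq_zero_iff two_ne_zero |>.1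
    (le_antisymm h0 (sq_nonneg _))))

theorem IsProxSlope.norm_le {f : E → ℝ} {δ M : ℝ} {a γ : E} (h : IsProxSlope f δ a γ)
    (hM : 0 ≤ M) (hf : ∀ p q, |f p - f q| ≤ M * ‖p - q‖) : ‖γ‖ ≤ M := by
  have h1 := h (a - δ • γ + γ)
  have h2 := (le_abs_self _).trans (hf (a - δ • γ + γ) (a - δ • γ))
  rw [add_sub_cancel_left] at h1 h2
  rw [real_inner_self_eq_norm_sq] at h1
  by_contra! hlt
  nlinarith [mul_lt_mul_of_pos_right hlt (hM.trans_lt hlt)]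

theorem IsProxSlope.gap_le {f : E → ℝ} {δ M : ℝ} {a γ : E} (h : IsProxSlope f δ a γ)
    (hδ : 0 ≤ δ) (hM : 0 ≤ M) (hf : ∀ p q, |f p - f q| ≤ M * ‖p - q‖) :
    f a ≤ f (a - δ • γ) + ⟪γ, a - (a - δ • γ)⟫ + δ * M ^ 2 := by
  have h1 := (le_abs_self _).trans (hf a (a - δ • γ))
  rw [sub_sub_cancel, norm_smul, Real.norm_of_nonneg hδ] at h1
  rw [sub_sub_cancel, real_inner_smul_right, real_inner_self_eq_norm_sq]
  have h2 : M * (δ * ‖γ‖) ≤ δ * M ^ 2 := by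
    nlinarith [mul_le_mul_of_nonneg_left (h.norm_le hM hf) (mul_nonneg hM hδ)]
  linarith [mul_nonneg hδ (sq_nonneg ‖γ‖)]

theorem exists_isProxSlope [ProperSpace E] {f : E → ℝ} {δ M : ℝ} (hδ : 0 < δ)
    (hconv : ConvexOn ℝ univ f) (hcont : Continuous f)
    (hf : ∀ p q, |f p - f q| ≤ M * ‖p - q‖) (a : E) : ∃ γ, IsProxSlope f δ a γ := by
  obtain ⟨q, hq⟩ : ∃ q, ∀ p, f q + ‖a - q‖ ^ 2 / (2 * δ) ≤ f p + ‖a - p‖ ^ 2 / (2 * δ) := by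
    refine Continuous.exists_forall_le' (f := fun p => f p + ‖a - p‖ ^ 2 / (2 * δ))
      (by fun_prop) a ?_
    filter_upwards [(isCompact_closedBall a (2 * δ * M)).compl_mem_cocompact] with p hp
    have hp' : 2 * δ * M < ‖a - p‖ := by
      simpa [dist_eq_norm, norm_sub_rev] using hp
    have h1 := (le_abs_self _).trans (hf a p)
    have h2 : M * ‖a - p‖ ≤ ‖a - p‖ ^ 2 / (2 * δ) := by
      rw [le_div_iff₀ (by positivity)]
      nlinarith [mul_le_mul_of_nonneg_right hp'.le (norm_nonneg (a - p))]
    simp only [sub_self, norm_zero]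
    norm_num
    linarith
  refine ⟨δ⁻¹ • (a - q), fun p => ?_⟩
  rw [smul_inv_smul₀ hδ.ne', sub_sub_cancel, real_inner_smul_left]
  have key : ∀ t ∈ Ioc (0 : ℝ) 1,
      f q + δ⁻¹ * ⟪a - q, p - q⟫ ≤ f p + t * (‖p - q‖ ^ 2 / (2 * δ)) := by
    rintro t ⟨ht0, ht1⟩
    have h1 := hq (q + t • (p - q))
    have h2 := hconv.2 (mem_univ q) (mem_univ p) (sub_nonneg.2 ht1) ht0.le (by ring)
    have e : (1 - t) • q + t • p = q + t • (p - q) := by module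
    have e' : ‖a - (q + t • (p - q))‖ ^ 2
        = ‖a - q‖ ^ 2 - 2 * (t * ⟪a - q, p - q⟫) + t ^ 2 * ‖p - q‖ ^ 2 := by
      rw [← sub_sub, norm_sub_sq_real, real_inner_smul_right, norm_smul, mul_pow,
        Real.norm_eq_abs, sq_abs]
    rw [e, smul_eq_mul, smul_eq_mul] at h2
    rw [e'] at h1
    have e'' : (‖a - q‖ ^ 2 - 2 * (t * ⟪a - q, p - q⟫) + t ^ 2 * ‖p - q‖ ^ 2) / (2 * δ)
        = ‖a - q‖ ^ 2 / (2 * δ) - t * (δ⁻¹ * ⟪a - q, p - q⟫)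
          + t * (t * (‖p - q‖ ^ 2 / (2 * δ))) := by
      field_simp
    rw [e''] at h1
    refine le_of_mul_le_mul_left ?_ ht0
    linarith
  have hlim : Tendsto (fun t : ℝ => f p + t * (‖p - q‖ ^ 2 / (2 * δ))) (𝓝[>] 0) (𝓝 (f p)) := by
    have : Continuous fun t : ℝ => f p + t * (‖p - q‖ ^ 2 / (2 * δ)) := by fun_prop
    simpa using (this.tendsto 0).mono_left nhdsWithin_le_nhds
  exact ge_of_tendsto hlim
    (eventually_of_mem (Ioc_mem_nhdsGT zero_lt_one) key)

/-- Bounded proximal slopes depend continuously on the function and the base point. -/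
theorem continuousOn_of_isProxSlope [ProperSpace E] {X : Type*} [TopologicalSpace X]
    {K : Set X} {B : X → E → ℝ} (hB : Continuous fun z : X × E => B z.1 z.2)
    {ψ γ : X → E} (hψ : ContinuousOn ψ K) {δ M : ℝ} (hδ : 0 < δ)
    (hγ : ∀ x ∈ K, IsProxSlope (B x) δ (ψ x) (γ x)) (hM : ∀ x ∈ K, ‖γ x‖ ≤ M) :
    ContinuousOn γ K := by
  intro x hx
  refine (isCompact_closedBall (0 : E) M).tendsto_nhds_of_unique_mapClusterPt
    (eventually_mem_nhdsWithin.mono fun y hy => mem_closedBall_zero_iff.2 (hM y hy)) ?_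
  intro z _ hz
  obtain ⟨U, hU, hUz⟩ := mapClusterPt_iff_ultrafilter.1 hz
  refine IsProxSlope.unique hδ (fun p => ?_) (hγ x hx)
  have hUψ : Tendsto ψ U (𝓝 (ψ x)) := (hψ x hx).mono_left hU
  have hUx : Tendsto id (U : Filter X) (𝓝 x) := hU.trans nhdsWithin_le_nhds
  have hUq : Tendsto (fun y => ψ y - δ • γ y) U (𝓝 (ψ x - δ • z)) :=
    hUψ.sub (hUz.const_smul δ)
  have hl : Tendsto (fun y => B y (ψ y - δ • γ y) + ⟪γ y, p - (ψ y - δ • γ y)⟫) U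
      (𝓝 (B x (ψ x - δ • z) + ⟪z, p - (ψ x - δ • z)⟫)) :=
    ((hB.tendsto (x, _)).comp (hUx.prodMk_nhds hUq)).add
      (hUz.inner (tendsto_const_nhds.sub hUq))
  have hr : Tendsto (fun y => B y p) U (𝓝 (B x p)) :=
    (hB.tendsto (x, p)).comp (hUx.prodMk_nhds tendsto_const_nhds)
  exact le_of_tendsto_of_tendsto hl hr
    ((eventually_mem_nhdsWithin.filter_mono hU).mono fun y hy => hγ y hy p)

end ProximalSlope

/-- **Continuous selection lemma**: given `ψ ∈ C(∂Ω,ℝⁿ)` and `ε > 0`, there is a continuous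
selection `(γ,g)` with `(γ(x),g(x)) ∈ 𝒢(x)` (an affine minorant of `B(x,·)`) and
`B(x,ψ(x)) < ε + γ(x)·ψ(x) - g(x)` for all `x ∈ ∂Ω`. -/
theorem continuous_selection
    {n : ℕ} (Ω : Set (Euc n)) (ρ : Euc n → ℝ)
    -- (A0): Ω is a bounded domain with C¹ boundary, with C¹ defining function ρ
    (hΩ_open : IsOpen Ω) (hΩ_bdd : Bornology.IsBounded Ω) (hΩ_ne : Ω.Nonempty)
    (hρ_C1 : ContDiff ℝ 1 ρ)
    (hρ_neg : ∀ x ∈ Ω, ρ x < 0)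
    (hρ_pos : ∀ x ∉ closure Ω, 0 < ρ x)
    (hρ_grad : ∀ x ∈ frontier Ω, gradient ρ x ≠ 0)
    (H B : Euc n → Euc n → ℝ) (θ M_B : ℝ)
    (hH_cont : Continuous fun z : Euc n × Euc n => H z.1 z.2)
    -- (A1): coercivity of H
    (hH_coer : ∀ C : ℝ, ∃ r : ℝ, ∀ x ∈ closure Ω, ∀ p : Euc n, r ≤ ‖p‖ → C ≤ H x p)
    -- (A2): local Lipschitz continuity of H in p, uniform in x
    (hH_lip : ∀ R : ℝ, 0 < R → ∃ M : ℝ, 0 < M ∧ ∀ x ∈ closure Ω, ∀ p q : Euc n,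
      ‖p‖ ≤ R → ‖q‖ ≤ R → |H x p - H x q| ≤ M * ‖p - q‖)
    (hB_cont : Continuous fun z : Euc n × Euc n => B z.1 z.2)
    (hθ : 0 < θ) (hMB : 0 < M_B)
    -- (A3): obliqueness of B
    (hB_obl : ∀ x ∈ frontier Ω, ∀ p : Euc n, ∀ lam : ℝ, 0 ≤ lam →
      θ * lam ≤ B x (p + lam • gradient ρ x) - B x p)
    -- (A4): Lipschitz continuity of B in p
    (hB_lip : ∀ x ∈ frontier Ω, ∀ p q : Euc n, |B x p - B x q| ≤ M_B * ‖p - q‖)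
    -- (A5): convexity of B in p
    (hB_conv : ∀ x ∈ frontier Ω, ConvexOn ℝ univ (B x))
    (ψ : Euc n → Euc n) (hψ : ContinuousOn ψ (frontier Ω))
    (ε : ℝ) (hε : 0 < ε) :
    ∃ γ : Euc n → Euc n, ∃ g : Euc n → ℝ,
      ContinuousOn γ (frontier Ω) ∧ ContinuousOn g (frontier Ω) ∧
      ∀ x ∈ frontier Ω, InG B x (γ x) (g x) ∧
        B x (ψ x) < ε + ⟪γ x, ψ x⟫ - g x := by
  set δ := ε / (2 * M_B ^ 2) with hδ_def
  have hδ : 0 < δ := by positivity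
  have hδM : δ * M_B ^ 2 < ε := by
    rw [hδ_def]
    field_simp
    linarith
  have hBx : ∀ x, Continuous (B x) := fun x => hB_cont.comp (by fun_prop : Continuous (Prod.mk x))
  choose! γ hγ using fun x hx =>
    exists_isProxSlope hδ (hB_conv x hx) (hBx x) (hB_lip x hx) (ψ x)
  have hγ_cont : ContinuousOn γ (frontier Ω) :=
    continuousOn_of_isProxSlope hB_cont hψ hδ hγ
      fun x hx => (hγ x hx).norm_le hMB.le (hB_lip x hx)
  have hq : ContinuousOn (fun x => ψ x - δ • γ x) (frontier Ω) := hψ.sub (hγ_cont.const_smul δ)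
  refine ⟨γ, fun x => ⟪γ x, ψ x - δ • γ x⟫ - B x (ψ x - δ • γ x), hγ_cont,
    (hγ_cont.inner hq).sub (hB_cont.comp_continuousOn (continuousOn_id.prodMk hq)),
    fun x hx => ⟨fun p => ?_, ?_⟩⟩
  · have h := hγ x hx p
    rw [inner_sub_right] at h
    linarith
  · have h := (hγ x hx).gap_le hδ.le hMB.le (hB_lip x hx)
    rw [inner_sub_right] at h
    linarith

end
end

section
/- Stability of momenta along a curve: Let η ∈ Lip([0,T],ℝⁿ) with η([0,T]) ⊂ closure(Ω), let w ∈ Lip(closure(Ω)), {w_ε}_{ε>0} ⊂ Lip(closure(Ω)) and {p_ε}_{ε>0} ⊂ L^∞([0,T],ℝⁿ). Assume H is coercive and H(x,·), B(x,·) are convex, that w_ε → w uniformly on closure(Ω) as ε → 0, and that for a.e. t ∈ [0,T]: (d/dt)(w_ε∘η)(t) = p_ε(t)·η̇(t), H(η(t),p_ε(t)) ≤ ε, and B(η(t),p_ε(t)) ≤ ε whenever η(t) ∈ ∂Ω. Then there exists p ∈ L^∞([0,T],ℝⁿ) such that for a.e. t ∈ [0,T]: (d/dt)(w∘η)(t)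 = p(t)·η̇(t), H(η(t),p(t)) ≤ 0, and B(η(t),p(t)) ≤ 0 whenever η(t) ∈ ∂Ω. -/
open Set MeasureTheory
open scoped RealInnerProductSpace

noncomputable section

variable {n : ℕ}

open Filter Topology

/-- Derivatives of pointwise convergent absolutely continuous functions with uniformly bounded
derivatives asymptotically dominate, almost everywhere, the derivative of the limit. -/
lemma ae_exists_lt_deriv_of_tendsto {a b C : ℝ} (hab : a ≤ b) {F : ℝ → ℝ} {f : ℕ → ℝ → ℝ}
    (hF : AbsolutelyContinuousOnInterval F a b)
    (hf : ∀ k, AbsolutelyContinuousOnInterval (f k) a b)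
    (hC : ∀ k, ∀ᵐ t, t ∈ Icc a b → |deriv (f k) t| ≤ C)
    (hlim : ∀ t ∈ Icc a b, Tendsto (fun k => f k t) atTop (𝓝 (F t))) :
    ∀ᵐ t, t ∈ Icc a b → ∀ k : ℕ, ∀ δ > 0, ∃ j ≥ k, deriv F t - δ < deriv (f j) t := by
  let h : ℕ → ℝ → ℝ := fun j t => max (-|C|) (min |C| (deriv (f j) t))
  let G : ℕ → ℝ → ℝ := fun k t => ⨆ j, h (k + j) t
  have h_le : ∀ j t, h j t ≤ |C| := fun j t =>
    max_le (by linarith [abs_nonneg C]) (min_le_left _ _)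
  have le_h : ∀ j t, -|C| ≤ h j t := fun j t => le_max_left _ _
  have h_meas : ∀ j, Measurable (h j) := fun j =>
    measurable_const.max (measurable_const.min (measurable_deriv _))
  have h_bdd : ∀ k t, BddAbove (range fun j => h (k + j) t) := fun k t =>
    ⟨|C|, by rintro _ ⟨j, rfl⟩; exact h_le _ _⟩
  have G_meas : ∀ k, Measurable (G k) := fun k => Measurable.iSup fun j => h_meas _
  have G_le : ∀ k t, ‖G k t‖ ≤ |C| := fun k t => by
    rw [Real.norm_eq_abs, abs_le]
    exact ⟨(le_h (k + 0) t).trans (le_ciSup (h_bdd k t) 0), ciSup_le fun j => h_le _ _⟩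
  have G_int : ∀ k x y, IntervalIntegrable (G k) volume x y := fun k x y =>
    (intervalIntegrable_const (c := |C|)).mono_fun (G_meas k).aestronglyMeasurable
      (Eventually.of_forall fun t => by simpa using G_le k t)
  have h_eq : ∀ j, ∀ᵐ t, t ∈ Icc a b → h j t = deriv (f j) t := fun j => by
    filter_upwards [hC j] with t ht hmem
    obtain ⟨h₁, h₂⟩ := abs_le.1 ((ht hmem).trans (le_abs_self C))
    simp only [h]
    rw [min_eq_right h₂, max_eq_right h₁]
  have step : ∀ k, ∀ x ∈ Icc a b, ∀ y ∈ Icc a b, x ≤ y → F y - F x ≤ ∫ t in x..y, G k t := by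
    intro k x hx y hy hxy
    refine le_of_tendsto ((hlim y hy).sub (hlim x hx)) ?_
    filter_upwards [eventually_ge_atTop k] with j hj
    have hac : AbsolutelyContinuousOnInterval (f j) x y := (hf j).mono (by
      rw [uIcc_of_le hab, uIcc_of_le hxy]; exact Icc_subset_Icc hx.1 hy.2)
    rw [← hac.integral_deriv_eq_sub]
    refine intervalIntegral.integral_mono_ae_restrict hxy hac.intervalIntegrable_deriv
      (G_int k x y) ?_
    filter_upwards [ae_restrict_of_ae (h_eq j), ae_restrict_mem measurableSet_Icc] with t ht hmem
    rw [← ht ⟨hx.1.trans hmem.1, hmem.2.trans hy.2⟩]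
    obtain ⟨i, rfl⟩ := Nat.exists_eq_add_of_le hj
    exact le_ciSup (h_bdd k t) i
  have key : ∀ k, ∀ᵐ t, t ∈ Icc a b → deriv F t ≤ G k t := by
    intro k
    have ha : ∀ᵐ t : ℝ, t ≠ a := by simp [ae_iff]
    have hb : ∀ᵐ t : ℝ, t ≠ b := by simp [ae_iff]
    filter_upwards [hF.ae_differentiableAt, (G_int k a b).ae_hasDerivAt_integral, ha, hb]
      with t h₁ h₂ hta htb hmem
    rw [← uIcc_of_le hab] at hmem
    have hd := (h₁ hmem).hasDerivAt.sub (h₂ hmem a left_mem_uIcc)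
    rw [uIcc_of_le hab] at hmem
    have hanti : AntitoneOn (F - fun x => ∫ s in a..x, G k s) (Icc a b) := by
      intro x hx y hy hxy
      have h₃ := step k x hx y hy hxy
      rw [← intervalIntegral.integral_interval_sub_left (G_int k a y) (G_int k a x)] at h₃
      simp only [Pi.sub_apply]
      linarith
    have h₄ := hanti.derivWithin_nonpos (x := t)
    rw [derivWithin_of_mem_nhds (Icc_mem_nhds (lt_of_le_of_ne hmem.1 hta.symm)
      (lt_of_le_of_ne hmem.2 htb)), hd.deriv] at h₄
    linarith
  filter_upwards [ae_all_iff.2 key, ae_all_iff.2 h_eq] with t hk he hmem k δ hδ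
  obtain ⟨i, hi⟩ := exists_lt_of_lt_ciSup (show deriv F t - δ < ⨆ j, h (k + j) t from
    lt_of_lt_of_le (by linarith) (hk k hmem))
  exact ⟨k + i, Nat.le_add_right _ _, he (k + i) hmem ▸ hi⟩

/-- A bounded sequence of vectors satisfying approximate constraints, whose pairing with `v`
frequently almost exceeds `D`, has a limit point satisfying the exact constraints. -/
lemma exists_limit_momentum {E : Type*} [NormedAddCommGroup E] [InnerProductSpace ℝ E]
    [ProperSpace E] {q : ℕ → E} {r D : ℝ} {v : E} {e : ℕ → ℝ} (he : Tendsto e atTop (𝓝 0))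
    (hr : ∀ j, ‖q j‖ ≤ r) (hD : ∀ k : ℕ, ∀ δ > 0, ∃ j ≥ k, D - δ < ⟪q j, v⟫) :
    ∃ p : E, ‖p‖ ≤ r ∧ D ≤ ⟪p, v⟫ ∧
      ∀ φ : E → ℝ, Continuous φ → (∀ j, φ (q j) ≤ e j) → φ p ≤ 0 := by
  choose j hj hjD using fun k : ℕ => hD k (1 / ((k : ℝ) + 1)) (by positivity)
  obtain ⟨p, hp, s, hs, hlim⟩ := (isCompact_closedBall (0 : E) r).tendsto_subseq
    (x := fun k => q (j k)) (fun k => by simpa using hr (j k))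
  have hjs : Tendsto (fun k => j (s k)) atTop atTop :=
    (tendsto_atTop_mono hj tendsto_id).comp hs.tendsto_atTop
  refine ⟨p, by simpa using hp, ?_, fun φ hφ hle => ?_⟩
  · have h₁ : Tendsto (fun k => D - 1 / ((s k : ℝ) + 1)) atTop (𝓝 (D - 0)) :=
      tendsto_const_nhds.sub ((tendsto_one_div_add_atTop_nhds_zero_nat (𝕜 := ℝ)).comp
        hs.tendsto_atTop)
    rw [sub_zero] at h₁
    exact le_of_tendsto_of_tendsto' h₁ (hlim.inner tendsto_const_nhds) fun k => (hjD (s k)).le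
  · exact le_of_tendsto_of_tendsto' ((hφ.tendsto p).comp hlim) (he.comp hjs)
      fun k => hle (j (s k))

/-- In a convex set, a linear functional takes every value between two of its values. -/
lemma Convex.exists_inner_eq {E : Type*} [NormedAddCommGroup E] [InnerProductSpace ℝ E]
    {S : Set E} (hS : Convex ℝ S) {p p' v : E} {D : ℝ} (hp : p ∈ S) (hp' : p' ∈ S)
    (h : D ≤ ⟪p, v⟫) (h' : ⟪p', v⟫ ≤ D) : ∃ q ∈ S, ⟪q, v⟫ = D :=
  hS.isPreconnected.intermediate_value hp' hp (by fun_prop) ⟨h', h⟩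

/-- **Stability of momenta along a curve**: if `w_ε → w` uniformly, each `w_ε` carries momenta
`p_ε` along the Lipschitz curve `η` with errors `ε` in the Hamiltonian and boundary
inequalities, then `w` carries a momentum `p ∈ L^∞` along `η` with exact inequalities. -/
theorem momenta_stability
    {n : ℕ} (Ω : Set (Euc n)) (ρ : Euc n → ℝ)
    -- (A0): Ω is a bounded domain with C¹ boundary, with C¹ defining function ρ
    (hΩ_open : IsOpen Ω) (hΩ_bdd : Bornology.IsBounded Ω) (hΩ_ne : Ω.Nonempty)
    (hρ_C1 : ContDiff ℝ 1 ρ)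
    (hρ_neg : ∀ x ∈ Ω, ρ x < 0)
    (hρ_pos : ∀ x ∉ closure Ω, 0 < ρ x)
    (hρ_grad : ∀ x ∈ frontier Ω, gradient ρ x ≠ 0)
    (H B : Euc n → Euc n → ℝ) (θ M_B : ℝ)
    (hH_cont : Continuous fun z : Euc n × Euc n => H z.1 z.2)
    -- (A1): coercivity of H
    (hH_coer : ∀ C : ℝ, ∃ r : ℝ, ∀ x ∈ closure Ω, ∀ p : Euc n, r ≤ ‖p‖ → C ≤ H x p)
    -- (A2): local Lipschitz continuity of H in p, uniform in x
    (hH_lip : ∀ R : ℝ, 0 < R → ∃ M : ℝ, 0 < M ∧ ∀ x ∈ closure Ω, ∀ p q : Euc n,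
      ‖p‖ ≤ R → ‖q‖ ≤ R → |H x p - H x q| ≤ M * ‖p - q‖)
    (hB_cont : Continuous fun z : Euc n × Euc n => B z.1 z.2)
    (hθ : 0 < θ) (hMB : 0 < M_B)
    -- (A3): obliqueness of B
    (hB_obl : ∀ x ∈ frontier Ω, ∀ p : Euc n, ∀ lam : ℝ, 0 ≤ lam →
      θ * lam ≤ B x (p + lam • gradient ρ x) - B x p)
    -- (A4): Lipschitz continuity of B in p
    (hB_lip : ∀ x ∈ frontier Ω, ∀ p q : Euc n, |B x p - B x q| ≤ M_B * ‖p - q‖)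
    -- (A5): convexity of B in p
    (hB_conv : ∀ x ∈ frontier Ω, ConvexOn ℝ univ (B x))
    (hH_conv : ∀ x ∈ closure Ω, ConvexOn ℝ univ (H x))
    (hB_conv'' : ∀ x ∈ closure Ω, ConvexOn ℝ univ (B x))
    -- η is a Lipschitz curve in closure Ω
    (T : ℝ) (hT : 0 < T) (η : ℝ → Euc n)
    (hη_lip : ∃ K : NNReal, LipschitzOnWith K η (Icc (0:ℝ) T))
    (hη_mem : ∀ t ∈ Icc (0:ℝ) T, η t ∈ closure Ω)
    (w : Euc n → ℝ) (hw_lip : ∃ K : NNReal, LipschitzOnWith K w (closure Ω))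
    (wε : ℝ → Euc n → ℝ)
    (hwε_lip : ∀ ε : ℝ, 0 < ε → ∃ K : NNReal, LipschitzOnWith K (wε ε) (closure Ω))
    (pε : ℝ → ℝ → Euc n)
    (hpε_bdd : ∀ ε : ℝ, 0 < ε →
      ∃ M : ℝ, ∀ᵐ t ∂(volume.restrict (Icc (0:ℝ) T)), ‖pε ε t‖ ≤ M)
    -- uniform convergence wε → w as ε → 0⁺
    (hconv : TendstoUniformlyOn (fun ε => wε ε) w (nhdsWithin 0 (Ioi (0:ℝ))) (closure Ω))
    -- the approximate momentum conditions
    (hae : ∀ ε : ℝ, 0 < ε → ∀ᵐ t ∂(volume.restrict (Icc (0:ℝ) T)),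
      HasDerivAt (fun s => wε ε (η s)) ⟪pε ε t, deriv η t⟫ t ∧
      H (η t) (pε ε t) ≤ ε ∧
      (η t ∈ frontier Ω → B (η t) (pε ε t) ≤ ε)) :
    ∃ p : ℝ → Euc n,
      (∃ M : ℝ, ∀ᵐ t ∂(volume.restrict (Icc (0:ℝ) T)), ‖p t‖ ≤ M) ∧
      ∀ᵐ t ∂(volume.restrict (Icc (0:ℝ) T)),
        HasDerivAt (fun s => w (η s)) ⟪p t, deriv η t⟫ t ∧
        H (η t) (p t) ≤ 0 ∧
        (η t ∈ frontier Ω → B (η t) (p t) ≤ 0) := by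
  obtain ⟨r, hr⟩ := hH_coer 2
  obtain ⟨K, hK⟩ := hη_lip
  let e : ℕ → ℝ := fun k => 1 / ((k : ℝ) + 1)
  have e_pos : ∀ k, 0 < e k := fun k => by positivity
  have e_le : ∀ k, e k ≤ 1 := fun k => by
    rw [div_le_one (by positivity)]; linarith [(Nat.cast_nonneg k : (0 : ℝ) ≤ k)]
  have e_lim : Tendsto e atTop (𝓝 0) := tendsto_one_div_add_atTop_nhds_zero_nat
  have ac : ∀ u : Euc n → ℝ, (∃ L : NNReal, LipschitzOnWith L u (closure Ω)) →
      AbsolutelyContinuousOnInterval (fun s => u (η s)) 0 T := by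
    rintro u ⟨L, hL⟩
    refine LipschitzOnWith.absolutelyContinuousOnInterval (K := L * K) ?_
    rw [uIcc_of_le hT.le]
    exact hL.comp hK hη_mem
  have hF := ac w hw_lip
  have hf := fun k => ac (wε (e k)) (hwε_lip _ (e_pos k))
  have norm_le : ∀ t ∈ Icc 0 T, ∀ k, ∀ q, H (η t) q ≤ e k → ‖q‖ ≤ r := by
    intro t ht k q hq
    by_contra! hlt
    linarith [hr _ (hη_mem t ht) q hlt.le, e_le k]
  have good : ∀ᵐ t, t ∈ Icc 0 T → ∀ k,
      HasDerivAt (fun s => wε (e k) (η s)) ⟪pε (e k) t, deriv η t⟫ t ∧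
      H (η t) (pε (e k) t) ≤ e k ∧ (η t ∈ frontier Ω → B (η t) (pε (e k) t) ≤ e k) := by
    have h := ae_all_iff.2 fun k => hae (e k) (e_pos k)
    rwa [ae_restrict_iff' measurableSet_Icc] at h
  have hC : ∀ k, ∀ᵐ t, t ∈ Icc 0 T → |deriv (fun s => wε (e k) (η s)) t| ≤ r * K := by
    intro k
    have h0 : ∀ᵐ t : ℝ, t ≠ 0 := by simp [ae_iff]
    have h1 : ∀ᵐ t : ℝ, t ≠ T := by simp [ae_iff]
    filter_upwards [good, h0, h1] with t ht ht0 htT hmem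
    obtain ⟨hd, hH, -⟩ := ht hmem k
    have hv : ‖deriv η t‖ ≤ K := norm_deriv_le_of_lipschitzOn
      (Icc_mem_nhds (lt_of_le_of_ne hmem.1 ht0.symm) (lt_of_le_of_ne hmem.2 htT)) hK
    have hp := norm_le t hmem k _ hH
    rw [hd.deriv]
    exact (abs_real_inner_le_norm _ _).trans
      (mul_le_mul hp hv (norm_nonneg _) ((norm_nonneg _).trans hp))
  have hlim : ∀ t ∈ Icc 0 T, Tendsto (fun k => wε (e k) (η t)) atTop (𝓝 (w (η t))) :=
    fun t ht => (hconv.tendsto_at (hη_mem t ht)).comp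
      (tendsto_nhdsWithin_iff.2 ⟨e_lim, Eventually.of_forall e_pos⟩)
  have up := ae_exists_lt_deriv_of_tendsto hT.le hF hf hC hlim
  have down := ae_exists_lt_deriv_of_tendsto (C := r * K) hT.le hF.neg (fun k => (hf k).neg)
    (fun k => by simpa only [deriv.neg, abs_neg] using hC k) (fun t ht => (hlim t ht).neg)
  have main : ∀ᵐ t, t ∈ Icc 0 T → ∃ p : Euc n, ‖p‖ ≤ r ∧
      HasDerivAt (fun s => w (η s)) ⟪p, deriv η t⟫ t ∧ H (η t) p ≤ 0 ∧
      (η t ∈ frontier Ω → B (η t) p ≤ 0) := by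
    filter_upwards [hF.ae_differentiableAt, good, up, down] with t hd hg hu hl hmem
    have hx := hη_mem t hmem
    have hq : ∀ k, ‖pε (e k) t‖ ≤ r := fun k => norm_le t hmem k _ (hg hmem k).2.1
    have hHc : Continuous (H (η t)) := hH_cont.comp (by fun_prop : Continuous fun p => (η t, p))
    have hBc : Continuous (B (η t)) := hB_cont.comp (by fun_prop : Continuous fun p => (η t, p))
    let S : Set (Euc n) := {p | ‖p‖ ≤ r ∧ H (η t) p ≤ 0 ∧ (η t ∈ frontier Ω → B (η t) p ≤ 0)}
    have hS : Convex ℝ S := by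
      intro p hp q hq a b ha hb hab
      refine ⟨?_, ?_, fun hfr => ?_⟩
      · simpa using convex_closedBall (0 : Euc n) r (by simpa using hp.1) (by simpa using hq.1)
          ha hb hab
      · exact (((hH_conv _ hx).convex_le 0) ⟨mem_univ _, hp.2.1⟩ ⟨mem_univ _, hq.2.1⟩
          ha hb hab).2
      · exact (((hB_conv'' _ hx).convex_le 0) ⟨mem_univ _, hp.2.2 hfr⟩ ⟨mem_univ _, hq.2.2 hfr⟩
          ha hb hab).2
    have hmemS : ∀ p : Euc n, ‖p‖ ≤ r →
        (∀ φ : Euc n → ℝ, Continuous φ → (∀ j, φ (pε (e j) t) ≤ e j) → φ p ≤ 0) → p ∈ S :=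
      fun p hp hφ => ⟨hp, hφ _ hHc fun j => (hg hmem j).2.1,
        fun hfr => hφ _ hBc fun j => (hg hmem j).2.2 hfr⟩
    obtain ⟨p₁, hp₁, hD₁, hφ₁⟩ := exists_limit_momentum (v := deriv η t)
      (D := deriv (fun s => w (η s)) t) e_lim hq fun k δ hδ => by
        obtain ⟨j, hj, hlt⟩ := hu hmem k δ hδ
        exact ⟨j, hj, (hg hmem j).1.deriv ▸ hlt⟩
    obtain ⟨p₂, hp₂, hD₂, hφ₂⟩ := exists_limit_momentum (v := -deriv η t)
      (D := -deriv (fun s => w (η s)) t) e_lim hq fun k δ hδ => by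
        obtain ⟨j, hj, hlt⟩ := hl hmem k δ hδ
        rw [deriv.neg, deriv.neg, (hg hmem j).1.deriv] at hlt
        exact ⟨j, hj, by rwa [inner_neg_right]⟩
    rw [inner_neg_right, neg_le_neg_iff] at hD₂
    obtain ⟨p, hp, hpD⟩ := hS.exists_inner_eq (hmemS p₁ hp₁ hφ₁) (hmemS p₂ hp₂ hφ₂) hD₁ hD₂
    refine ⟨p, hp.1, ?_, hp.2⟩
    rw [hpD]
    exact (hd (by rwa [uIcc_of_le hT.le])).hasDerivAt
  rw [← ae_restrict_iff' measurableSet_Icc] at main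
  have : (ae (volume.restrict (Icc 0 T))).NeBot := ae_restrict_neBot.2 (by simp [hT])
  obtain ⟨p, hp⟩ := main.choice
  exact ⟨p, ⟨r, hp.mono fun t ht => ht.1⟩, hp.mono fun t ht => ht.2⟩

end
end
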